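/- Let V be a type and Eb, Er binary relations on V such that the asymmetric part of the transitive closure of Eb admits no infinite walk and the asymmetric part of the transitive closure of Er admits no infinite walk. Let 𝒞 ⊆ 𝒮 be a nonempty chain for the order ≤ (any two members S, U ∈ 𝒞 satisfy S ≤ U or U ≤ S, where ≤ is ≤_{Asym(Eb⁺)}). Then S^∞_𝒞 itself belongs to 𝒮, i.e., S^∞_𝒞 is nonempty, M-independent, and every y with Er⁺ s y for some s ∈ S^∞_𝒞 satisfies M y s' for some s' ∈ S^∞_𝒞. -/

import Mathlib

/-- The asymmetric part of a binary relation. -/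
def Asym {V : Type*} (R : V → V → Prop) : V → V → Prop :=
  fun x y => R x y ∧ ¬ R y x

/-- `f` is an infinite (outward) walk for `R`. -/
def InfWalk {V : Type*} (R : V → V → Prop) (f : ℕ → V) : Prop :=
  ∀ n : ℕ, R (f n) (f (n + 1))

/-- The monochromatic relation: union of the two transitive closures. -/
def Mono {V : Type*} (Eb Er : V → V → Prop) : V → V → Prop :=
  fun x y => Relation.TransGen Eb x y ∨ Relation.TransGen Er x y

/-- `S` is `R`-independent. -/
def Indep {V : Type*} (R : V → V → Prop) (S : Set V) : Prop :=
  ∀ x ∈ S, ∀ y ∈ S, x = y ∨ ¬ R x y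

/-- The order `≤_R` on subsets induced by a relation `R`. -/
def leR {V : Type*} (R : V → V → Prop) (S T : Set V) : Prop :=
  ∀ s ∈ S, ∃ t ∈ T, s = t ∨ R s t

/-- The collection `𝒮` of nonempty `M`-independent sets `S` such that every
vertex reachable from `S` by a red path reaches `S` by a monochromatic path. -/
def Scal {V : Type*} (Eb Er : V → V → Prop) : Set (Set V) :=
  {S | S.Nonempty ∧ Indep (Mono Eb Er) S ∧
    ∀ y : V, (∃ s ∈ S, Relation.TransGen Er s y) → ∃ s' ∈ S, Mono Eb Er y s'}

/-- The set `S^∞_𝒞` associated to a collection `𝒞` of subsets. -/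
def Sinf {V : Type*} (Eb : V → V → Prop) (C : Set (Set V)) : Set V :=
  {s | ∃ S ∈ C, ∀ U ∈ C, leR (Asym (Relation.TransGen Eb)) S U → s ∈ U}

theorem asym_transGen_trans {V : Type*} {R : V → V → Prop} {x y z : V}
    (hxy : Asym (Relation.TransGen R) x y) (hyz : Asym (Relation.TransGen R) y z) :
    Asym (Relation.TransGen R) x z :=
  ⟨hxy.1.trans hyz.1, fun hzx => hxy.2 (hyz.1.trans hzx)⟩

theorem leR_refl {V : Type*} (R : V → V → Prop) (S : Set V) : leR R S S :=
  fun s hs => ⟨s, hs, Or.inl rfl⟩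

theorem leR_asym_transGen_trans {V : Type*} {R : V → V → Prop} {S T U : Set V}
    (hST : leR (Asym (Relation.TransGen R)) S T) (hTU : leR (Asym (Relation.TransGen R)) T U) :
    leR (Asym (Relation.TransGen R)) S U := by
  intro s hs
  obtain ⟨t, ht, rfl | hst⟩ := hST s hs
  · exact hTU s ht
  · obtain ⟨u, hu, rfl | htu⟩ := hTU t ht
    · exact ⟨t, hu, Or.inr hst⟩
    · exact ⟨u, hu, Or.inr (asym_transGen_trans hst htu)⟩

theorem wellFounded_flip_of_not_infWalk {V : Type*} {R : V → V → Prop}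
    (h : ¬ ∃ f : ℕ → V, InfWalk R f) : WellFounded (flip R) :=
  wellFounded_iff_isEmpty_descending_chain.2 ⟨fun f => h ⟨f.1, f.2⟩⟩

/-- `Sinf Eb C` is an upper bound of `C`. -/
theorem leR_Sinf {V : Type*} {Eb : V → V → Prop}
    (hb : ¬ ∃ f : ℕ → V, InfWalk (Asym (Relation.TransGen Eb)) f)
    {C : Set (Set V)} {S : Set V} (hS : S ∈ C) :
    leR (Asym (Relation.TransGen Eb)) S (Sinf Eb C) := by
  intro s hs
  obtain ⟨t, ⟨hst, U, hU, hSU, htU⟩, hmax⟩ :=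
    (wellFounded_flip_of_not_infWalk hb).has_min
      {t | (s = t ∨ Asym (Relation.TransGen Eb) s t) ∧
        ∃ U ∈ C, leR (Asym (Relation.TransGen Eb)) S U ∧ t ∈ U}
      ⟨s, Or.inl rfl, S, hS, leR_refl _ S, hs⟩
  refine ⟨t, ⟨U, hU, fun W hW hUW => ?_⟩, hst⟩
  obtain ⟨w, hw, rfl | htw⟩ := hUW t htU
  · exact hw
  · refine absurd htw (hmax w ⟨Or.inr ?_, W, hW, leR_asym_transGen_trans hSU hUW, hw⟩)
    obtain rfl | hst := hst
    · exact htw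
    · exact asym_transGen_trans hst htw

theorem stmt7 {V : Type*} (Eb Er : V → V → Prop)
    (hb : ¬ ∃ f : ℕ → V, InfWalk (Asym (Relation.TransGen Eb)) f)
    (hr : ¬ ∃ f : ℕ → V, InfWalk (Asym (Relation.TransGen Er)) f)
    (C : Set (Set V)) (hC : C ⊆ Scal Eb Er) (hne : C.Nonempty)
    (hchain : ∀ S ∈ C, ∀ U ∈ C,
      leR (Asym (Relation.TransGen Eb)) S U ∨ leR (Asym (Relation.TransGen Eb)) U S) :
    Sinf Eb C ∈ Scal Eb Er := by
  refine ⟨?_, ?_, ?_⟩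
  · obtain ⟨S, hS⟩ := hne
    obtain ⟨s, hs⟩ := (hC hS).1
    obtain ⟨t, ht, -⟩ := leR_Sinf hb hS s hs
    exact ⟨t, ht⟩
  · rintro x ⟨S, hS, hx⟩ y ⟨U, hU, hy⟩
    obtain hSU | hUS := hchain S hS U hU
    · exact (hC hU).2.1 x (hx U hU hSU) y (hy U hU (leR_refl _ U))
    · exact (hC hS).2.1 x (hx S hS (leR_refl _ S)) y (hy S hS hUS)
  · rintro y ⟨s, hs, hsy⟩
    obtain ⟨S, hS, hsS⟩ := id hs
    have hsS := hsS S hS (leR_refl _ S)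
    obtain ⟨s', hs', hys' | hys'⟩ := (hC hS).2.2 y ⟨s, hsS, hsy⟩
    · obtain ⟨t, ht, rfl | hst⟩ := leR_Sinf hb hS s' hs'
      · exact ⟨s', ht, Or.inl hys'⟩
      · exact ⟨t, ht, Or.inl (hys'.trans hst.1)⟩
    · obtain rfl | hns := (hC hS).2.1 s hsS s' hs'
      · exact ⟨s, hs, Or.inr hys'⟩
      · exact absurd (Or.inr (hsy.trans hys')) hns
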